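/- Let T be the Gauss map and μ the Gauss measure. Then the permutation entropy of T equals its Kolmogorov-Sinai entropy: h^{PE}(T) = h(T). -/

import Mathlib

open MeasureTheory Real Filter
open scoped symmDiff

noncomputable def shEntropy {α I : Type*} [MeasurableSpace α] (μ : Measure α) (P : I → Set α) : ℝ :=
  ∑' i, Real.negMulLog (μ (P i)).toReal

def IsPartitionOf {I : Type*} (Ω : Set ℝ) (P : I → Set ℝ) : Prop :=
  (Pairwise fun i j => Disjoint (P i) (P j)) ∧ (⋃ i, P i) = Ω

def IsIntervalIn (Ω A : Set ℝ) : Prop :=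
  A ⊆ Ω ∧ ∀ x ∈ A, ∀ z ∈ A, ∀ y ∈ Ω, x ≤ y → y ≤ z → y ∈ A

def IsMonotonyPartition {I : Type*} (Ω : Set ℝ) (T : ℝ → ℝ) (M : I → Set ℝ) : Prop :=
  IsPartitionOf Ω M ∧ ∀ i, IsIntervalIn Ω (M i) ∧ (MonotoneOn T (M i) ∨ StrictAntiOn T (M i))

def multiCell {I : Type*} (T : ℝ → ℝ) (P : I → Set ℝ) (n : ℕ) (a : Fin n → I) : Set ℝ :=
  ⋂ k : Fin n, T^[(k : ℕ)] ⁻¹' P (a k)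

def ordCell (Ω : Set ℝ) (T : ℝ → ℝ) (n : ℕ) (pp : Equiv.Perm (Fin n)) : Set ℝ :=
  {ω ∈ Ω | ∀ k l : Fin n, k ≤ l → T^[((pp k : Fin n) : ℕ)] ω ≤ T^[((pp l : Fin n) : ℕ)] ω}

noncomputable def entropyRate {I : Type*} (μ : Measure ℝ) (T : ℝ → ℝ) (P : I → Set ℝ) : ℝ :=
  liminf (fun n : ℕ => shEntropy μ (multiCell T P n) / (n : ℝ)) atTop

noncomputable def permEntropy (Ω : Set ℝ) (μ : Measure ℝ) (T : ℝ → ℝ) : ℝ :=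
  liminf (fun n : ℕ => shEntropy μ (ordCell Ω T n) / (n : ℝ)) atTop

noncomputable def ksEntropy (Ω : Set ℝ) (μ : Measure ℝ) (T : ℝ → ℝ) : ℝ :=
  sSup {h : ℝ | ∃ P : ℕ → Set ℝ, IsPartitionOf Ω P ∧ (∀ i, MeasurableSet (P i)) ∧
    (Summable fun i => Real.negMulLog (μ (P i)).toReal) ∧ h = entropyRate μ T P}

def Aperiodic (μ : Measure ℝ) (T : ℝ → ℝ) : Prop :=
  μ {ω | ∃ t, 1 ≤ t ∧ T^[t] ω = ω} = 0

noncomputable def gaussMap : ℝ → ℝ := fun ω => if ω = 0 then 0 else Int.fract ω⁻¹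

noncomputable def gaussMeasure : Measure ℝ :=
  (volume.restrict (Set.Icc (0 : ℝ) 1)).withDensity
    fun x => ENNReal.ofReal ((Real.log 2)⁻¹ * (1 + x)⁻¹)

open scoped ENNReal

/-- The Shannon entropy of a discrete random variable, as an extended nonnegative real. -/
noncomputable def ent {Ω I : Type*} [MeasurableSpace Ω] (μ : Measure Ω) (X : Ω → I) : ℝ≥0∞ :=
  ∑' i, ENNReal.ofReal (negMulLog (μ (X ⁻¹' {i})).toReal)

/-- A map into a discrete space all of whose fibres are measurable. -/
def FibreMeasurable {Ω I : Type*} [MeasurableSpace Ω] (X : Ω → I) : Prop :=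
  ∀ i, MeasurableSet (X ⁻¹' {i})

section Entropy

lemma preimage_prodMk_singleton {Ω I J : Type*} (X : Ω → I) (Y : Ω → J) (i : I) (j : J) :
    (fun ω => (X ω, Y ω)) ⁻¹' {(i, j)} = X ⁻¹' {i} ∩ Y ⁻¹' {j} := by
  ext ω; simp

variable {Ω I J K : Type*} [MeasurableSpace Ω] {μ : Measure Ω}

lemma FibreMeasurable.prodMk {X : Ω → I} {Y : Ω → J} (hX : FibreMeasurable X)
    (hY : FibreMeasurable Y) : FibreMeasurable fun ω => (X ω, Y ω) := by
  rintro ⟨i, j⟩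
  rw [preimage_prodMk_singleton]
  exact (hX i).inter (hY j)

lemma FibreMeasurable.preimage [Countable I] {X : Ω → I} (hX : FibreMeasurable X) (s : Set I) :
    MeasurableSet (X ⁻¹' s) := by
  rw [← Set.biUnion_preimage_singleton]
  exact MeasurableSet.biUnion s.to_countable fun i _ => hX i

lemma FibreMeasurable.comp_left [Countable I] {X : Ω → I} (hX : FibreMeasurable X) (f : I → J) :
    FibreMeasurable fun ω => f (X ω) :=
  fun j => hX.preimage (f ⁻¹' {j})

lemma FibreMeasurable.pi [Finite K] {X : K → Ω → I} (hX : ∀ k, FibreMeasurable (X k)) :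
    FibreMeasurable fun ω k => X k ω := by
  intro a
  have : (fun ω k => X k ω) ⁻¹' {a} = ⋂ k, X k ⁻¹' {a k} := by
    ext ω; simp [funext_iff]
  rw [this]
  exact MeasurableSet.iInter fun k => hX k _

lemma FibreMeasurable.comp {Ω' : Type*} [MeasurableSpace Ω'] {X : Ω → I} (hX : FibreMeasurable X)
    {T : Ω' → Ω} (hT : Measurable T) : FibreMeasurable fun ω => X (T ω) :=
  fun i => hT (hX i)

lemma fibreMeasurable_prop {p : Ω → Prop} (hp : MeasurableSet {ω | p ω}) : FibreMeasurable p := by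
  intro q
  by_cases hq : q
  · convert hp using 1
    ext ω; simp [hq]
  · convert hp.compl using 1
    ext ω; simp [hq]

lemma tsum_measure_inter_fibre [Countable J] {Y : Ω → J} (hY : FibreMeasurable Y) {s : Set Ω}
    (hs : MeasurableSet s) : ∑' j, μ (s ∩ Y ⁻¹' {j}) = μ s := by
  rw [← measure_iUnion (fun j k hjk => ?_) (fun j => hs.inter (hY j)), ← Set.inter_iUnion]
  · congr 1
    ext ω; simp
  · refine Set.disjoint_left.2 ?_
    rintro ω ⟨-, h1⟩ ⟨-, h2⟩
    exact hjk (h1.symm.trans h2)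

lemma ent_eq_tsum_mul [IsFiniteMeasure μ] (X : Ω → I) :
    ent μ X = ∑' i, μ (X ⁻¹' {i}) * ENNReal.ofReal (-log (μ (X ⁻¹' {i})).toReal) := by
  refine tsum_congr fun i => ?_
  rw [negMulLog, neg_mul_comm, ENNReal.ofReal_mul ENNReal.toReal_nonneg,
    ENNReal.ofReal_toReal (measure_ne_top _ _)]

lemma ent_eq_tsum_joint [IsFiniteMeasure μ] [Countable J] {X : Ω → I} {Y : Ω → J}
    (hX : FibreMeasurable X) (hY : FibreMeasurable Y) :
    ent μ X = ∑' i, ∑' j, μ (X ⁻¹' {i} ∩ Y ⁻¹' {j}) *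
      ENNReal.ofReal (-log (μ (X ⁻¹' {i})).toReal) := by
  rw [ent_eq_tsum_mul]
  refine tsum_congr fun i => ?_
  rw [ENNReal.tsum_mul_right, tsum_measure_inter_fibre hY (hX i)]

/-- If `Y` almost surely determines `X`, then `X` has at most the entropy of `Y`. -/
lemma ent_le_of_determines [IsFiniteMeasure μ] [Countable I] [Countable J] {X : Ω → I}
    {Y : Ω → J} (hX : FibreMeasurable X) (hY : FibreMeasurable Y) {G : Set Ω}
    (hG : ∀ᵐ ω ∂μ, ω ∈ G) (h : ∀ ω ∈ G, ∀ ω' ∈ G, Y ω = Y ω' → X ω = X ω') :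
    ent μ X ≤ ent μ Y := by
  rw [ent_eq_tsum_joint hX hY, ent_eq_tsum_joint hY hX, ENNReal.tsum_comm]
  refine ENNReal.tsum_le_tsum fun j => ENNReal.tsum_le_tsum fun i => ?_
  rw [Set.inter_comm]
  by_cases h0 : μ (Y ⁻¹' {j} ∩ X ⁻¹' {i}) = 0
  · simp [h0]
  have hpos : 0 < (μ (Y ⁻¹' {j})).toReal :=
    ENNReal.toReal_pos (fun h1 => h0 (measure_mono_null Set.inter_subset_left h1))
      (measure_ne_top _ _)
  have hle : μ (Y ⁻¹' {j}) ≤ μ (X ⁻¹' {i}) := by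
    refine measure_mono_ae ?_
    have : ∃ ω ∈ G, Y ω = j ∧ X ω = i := by
      by_contra! hcon
      refine h0 (measure_mono_null ?_ hG)
      rintro ω ⟨h1, h2⟩ h3
      exact hcon ω h3 h1 h2
    obtain ⟨ω, hω, rfl, rfl⟩ := this
    filter_upwards [hG] with ω' hω' hY'
    exact h ω' hω' ω hω hY'
  exact mul_le_mul' le_rfl (ENNReal.ofReal_le_ofReal (neg_le_neg
    (log_le_log hpos (ENNReal.toReal_mono (measure_ne_top _ _) hle))))

lemma ent_prodMk_le [IsProbabilityMeasure μ] [Countable I] [Countable J] {X : Ω → I}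
    {Y : Ω → J} (hX : FibreMeasurable X) (hY : FibreMeasurable Y) :
    ent μ (fun ω => (X ω, Y ω)) ≤ ent μ X + ent μ Y := by
  have hX1 : ∑' i, μ (X ⁻¹' {i}) = 1 := by
    simpa using tsum_measure_inter_fibre (μ := μ) hX MeasurableSet.univ
  have hY1 : ∑' i, μ (Y ⁻¹' {i}) = 1 := by
    simpa using tsum_measure_inter_fibre (μ := μ) hY MeasurableSet.univ
  have key : ent μ (fun ω => (X ω, Y ω)) + 1 ≤ ent μ X + ent μ Y + 1 := by
    have e1 : (1 : ℝ≥0∞) = ∑' i, ∑' j, μ (X ⁻¹' {i} ∩ Y ⁻¹' {j}) := by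
      rw [← hX1]
      exact tsum_congr fun i => (tsum_measure_inter_fibre hY (hX i)).symm
    have e2 : (1 : ℝ≥0∞) = ∑' i, ∑' j, μ (X ⁻¹' {i}) * μ (Y ⁻¹' {j}) := by
      simp_rw [ENNReal.tsum_mul_left, hY1, mul_one, hX1]
    nth_rewrite 1 [e1]
    nth_rewrite 1 [e2]
    rw [ent_eq_tsum_joint hX hY, ent_eq_tsum_joint hY hX, ENNReal.tsum_comm (α := J), ent,
      ENNReal.tsum_prod']
    simp_rw [← ENNReal.tsum_add, preimage_prodMk_singleton]
    refine ENNReal.tsum_le_tsum fun i => ENNReal.tsum_le_tsum fun j => ?_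
    rw [Set.inter_comm (Y ⁻¹' {j})]
    by_cases h0 : μ (X ⁻¹' {i} ∩ Y ⁻¹' {j}) = 0
    · simp [h0]
    have hl := measure_mono (μ := μ) (Set.inter_subset_left (s := X ⁻¹' {i}) (t := Y ⁻¹' {j}))
    have hr := measure_mono (μ := μ) (Set.inter_subset_right (s := X ⁻¹' {i}) (t := Y ⁻¹' {j}))
    have hi := prob_le_one (μ := μ) (s := X ⁻¹' {i})
    have hj := prob_le_one (μ := μ) (s := Y ⁻¹' {j})
    generalize μ (X ⁻¹' {i} ∩ Y ⁻¹' {j}) = p at *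
    generalize μ (X ⁻¹' {i}) = q at *
    generalize μ (Y ⁻¹' {j}) = r at *
    lift q to NNReal using (hi.trans_lt ENNReal.one_lt_top).ne
    lift r to NNReal using (hj.trans_lt ENNReal.one_lt_top).ne
    lift p to NNReal using (hl.trans_lt ENNReal.coe_lt_top).ne
    norm_cast at *
    have hp : (0 : ℝ) < p := by positivity
    have hq : (0 : ℝ) < q := hp.trans_le (by exact_mod_cast hl)
    have hr' : (0 : ℝ) < r := hp.trans_le (by exact_mod_cast hr)
    have lq : 0 ≤ -log (q : ℝ) := neg_nonneg.2 (log_nonpos hq.le (by exact_mod_cast hi))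
    have lr : 0 ≤ -log (r : ℝ) := neg_nonneg.2 (log_nonpos hr'.le (by exact_mod_cast hj))
    have lp : 0 ≤ negMulLog (p : ℝ) :=
      negMulLog_nonneg hp.le (by exact_mod_cast hl.trans hi)
    simp only [ENNReal.coe_toReal]
    have c : ∀ x : NNReal, (x : ℝ≥0∞) = ENNReal.ofReal (x : ℝ) := fun x => by simp
    rw [c p, ENNReal.coe_mul, c q, c r]
    rw [← ENNReal.ofReal_mul hp.le, ← ENNReal.ofReal_mul hp.le, ← ENNReal.ofReal_mul hq.le,
      ← ENNReal.ofReal_add lp hp.le, ← ENNReal.ofReal_add (by positivity) (by positivity),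
      ← ENNReal.ofReal_add (by positivity) (by positivity)]
    refine ENNReal.ofReal_le_ofReal ?_
    have := log_le_sub_one_of_pos (x := (q : ℝ) * r / p) (by positivity)
    rw [log_div (by positivity) hp.ne', log_mul hq.ne' hr'.ne'] at this
    have h2 := mul_le_mul_of_nonneg_left this hp.le
    have h3 : (p : ℝ) * (q * r / p - 1) = q * r - p := by field_simp
    rw [h3] at h2
    rw [negMulLog]
    nlinarith
  exact (ENNReal.add_le_add_iff_right ENNReal.one_ne_top).1 key

lemma ent_le_log_card [IsProbabilityMeasure μ] [Fintype I] [Nonempty I] {X : Ω → I}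
    (hX : FibreMeasurable X) : ent μ X ≤ ENNReal.ofReal (log (Fintype.card I)) := by
  have h1 : ∑ i, (μ (X ⁻¹' {i})).toReal = 1 := by
    rw [← ENNReal.toReal_sum fun i _ => measure_ne_top _ _,
      ← tsum_fintype (L := SummationFilter.unconditional I)]
    simpa using congrArg ENNReal.toReal (tsum_measure_inter_fibre (μ := μ) hX MeasurableSet.univ)
  have hN : (0 : ℝ) < Fintype.card I := by exact_mod_cast Fintype.card_pos
  rw [ent, tsum_fintype, ← ENNReal.ofReal_sum_of_nonneg]
  · refine ENNReal.ofReal_le_ofReal ?_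
    calc ∑ i, negMulLog (μ (X ⁻¹' {i})).toReal
        ≤ ∑ i, ((μ (X ⁻¹' {i})).toReal * log (Fintype.card I)
          + ((Fintype.card I : ℝ)⁻¹ - (μ (X ⁻¹' {i})).toReal)) := by
          refine Finset.sum_le_sum fun i _ => ?_
          rcases (ENNReal.toReal_nonneg (a := μ (X ⁻¹' {i}))).eq_or_lt with h | h
          · simp [← h]
          generalize (μ (X ⁻¹' {i})).toReal = p at *
          generalize (Fintype.card I : ℝ) = N at *
          have := log_le_sub_one_of_pos (x := (N * p)⁻¹) (by positivity)
          rw [log_inv, log_mul hN.ne' h.ne'] at this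
          have h2 := mul_le_mul_of_nonneg_left this h.le
          have h3 : p * ((N * p)⁻¹ - 1) = N⁻¹ - p := by field_simp
          rw [h3] at h2
          rw [negMulLog]
          linarith
      _ = log (Fintype.card I) := by
          rw [Finset.sum_add_distrib, ← Finset.sum_mul, h1, Finset.sum_sub_distrib, h1]
          simp [hN.ne']
  · exact fun i _ => negMulLog_nonneg ENNReal.toReal_nonneg measureReal_le_one

lemma ent_comp_measurePreserving {T : Ω → Ω} (hT : MeasurePreserving T μ μ) {X : Ω → I}
    (hX : FibreMeasurable X) : ent μ (fun ω => X (T ω)) = ent μ X := by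
  refine tsum_congr fun i => ?_
  rw [← hT.measure_preimage (hX i).nullMeasurableSet]
  rfl

/-- The first `n` letters of the itinerary of a point under `T`. -/
def word (T : Ω → Ω) (X : Ω → I) (n : ℕ) (ω : Ω) : Fin n → I := fun k => X (T^[k] ω)

lemma FibreMeasurable.word {T : Ω → Ω} (hT : Measurable T) {X : Ω → I} (hX : FibreMeasurable X)
    (n : ℕ) : FibreMeasurable (word T X n) :=
  FibreMeasurable.pi fun k => hX.comp (hT.iterate k)

lemma ent_word_le [IsProbabilityMeasure μ] [Countable I] {T : Ω → Ω}
    (hT : MeasurePreserving T μ μ) {X : Ω → I} (hX : FibreMeasurable X) (n : ℕ) :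
    ent μ (word T X n) ≤ n * ent μ X := by
  induction n with
  | zero =>
    have := ent_le_log_card (μ := μ) (FibreMeasurable.word hT.measurable hX 0)
    simpa using this
  | succ n ih =>
    have hn := FibreMeasurable.word hT.measurable hX n
    have hTn := hX.comp (hT.measurable.iterate n)
    calc ent μ (word T X (n + 1)) ≤ ent μ (fun ω => (word T X n ω, X (T^[n] ω))) := by
          refine ent_le_of_determines (G := Set.univ) (FibreMeasurable.word hT.measurable hX _)
            (hn.prodMk hTn) (by simp) ?_
          intro ω _ ω' _ h
          rw [Prod.mk.injEq] at h
          funext k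
          refine Fin.lastCases ?_ (fun k => ?_) k
          · exact h.2
          · exact congrFun h.1 k
      _ ≤ ent μ (word T X n) + ent μ (fun ω => X (T^[n] ω)) := ent_prodMk_le hn hTn
      _ ≤ n * ent μ X + ent μ X := by
          rw [ent_comp_measurePreserving (hT.iterate n) hX]
          gcongr
      _ = (n + 1 : ℕ) * ent μ X := by push_cast; ring

end Entropy

section OrderPatterns

/-- A set which is a union of atoms of the partition of the line by finitely many cut points. -/
def IsCutSet (B : Set ℝ) : Prop :=
  ∃ F : Finset ℝ, ∀ x y, (∀ c ∈ F, x ≤ c ↔ y ≤ c) → (x ∈ B ↔ y ∈ B)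

lemma IsCutSet.measurableSet {B : Set ℝ} (hB : IsCutSet B) : MeasurableSet B := by
  obtain ⟨F, hF⟩ := hB
  have hφ : FibreMeasurable fun (x : ℝ) (c : F) => x ≤ (c : ℝ) :=
    FibreMeasurable.pi fun c => fibreMeasurable_prop measurableSet_Iic
  have : B = (fun (x : ℝ) (c : F) => x ≤ (c : ℝ)) ⁻¹'
      ((fun (x : ℝ) (c : F) => x ≤ (c : ℝ)) '' B) := by
    refine (Set.subset_preimage_image _ _).antisymm ?_
    rintro x ⟨y, hy, hxy⟩
    exact (hF y x fun c hc => iff_of_eq (congrFun hxy ⟨c, hc⟩)).1 hy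
  rw [this]
  exact hφ.preimage _

lemma isSetAlgebra_isCutSet : IsSetAlgebra {B | IsCutSet B} where
  empty_mem := ⟨∅, by simp⟩
  compl_mem := by
    rintro s ⟨F, hF⟩
    exact ⟨F, fun x y h => not_congr (hF x y h)⟩
  union_mem := by
    classical
    rintro s t ⟨F, hF⟩ ⟨F', hF'⟩
    exact ⟨F ∪ F', fun x y h => or_congr (hF x y fun c hc => h c (Finset.mem_union_left _ hc))
      (hF' x y fun c hc => h c (Finset.mem_union_right _ hc))⟩

lemma measureDense_isCutSet (μ : Measure ℝ) [IsFiniteMeasure μ] :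
    μ.MeasureDense {B | IsCutSet B} := by
  refine Measure.MeasureDense.of_generateFrom_isSetAlgebra_finite μ isSetAlgebra_isCutSet ?_
  refine le_antisymm ?_ (MeasurableSpace.generateFrom_le fun B hB => hB.measurableSet)
  rw [BorelSpace.measurable_eq (α := ℝ), borel_eq_generateFrom_Iic ℝ]
  refine MeasurableSpace.generateFrom_mono ?_
  rintro _ ⟨c, rfl⟩
  exact ⟨{c}, fun x y h => h c (by simp)⟩

/-- The permutation that sorts the first `n` points of an orbit. -/
noncomputable def orbitPattern (T : ℝ → ℝ) (n : ℕ) (ω : ℝ) : Equiv.Perm (Fin n) :=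
  Tuple.sort fun k : Fin n => T^[k] ω

lemma fibreMeasurable_orbitPattern {T : ℝ → ℝ} (hT : Measurable T) (n : ℕ) :
    FibreMeasurable (orbitPattern T n) := by
  intro σ
  have hm : ∀ k : Fin n, Measurable fun ω => T^[k] ω := fun k => hT.iterate k
  have : orbitPattern T n ⁻¹' {σ} =
      (⋂ k : Fin n, ⋂ l : Fin n, ⋂ _ : k ≤ l, {ω | T^[σ k] ω ≤ T^[σ l] ω}) ∩
      ⋂ k : Fin n, ⋂ l : Fin n, ⋂ _ : k < l, ⋂ _ : ¬ σ k < σ l, {ω | T^[σ k] ω = T^[σ l] ω}ᶜ := by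
    ext ω
    refine (eq_comm.trans Tuple.eq_sort_iff).trans ?_
    simp only [Set.mem_inter_iff, Set.mem_iInter, Set.mem_compl_iff, Set.mem_ofPred_eq]
    exact and_congr Iff.rfl (forall_congr' fun k => forall_congr' fun l =>
      forall_congr' fun _ => not_imp_not.symm)
  rw [this]
  exact .inter (.iInter fun k => .iInter fun l => .iInter fun _ => measurableSet_le (hm _) (hm _))
    (.iInter fun k => .iInter fun l => .iInter fun _ => .iInter fun _ =>
      (measurableSet_eq_fun (hm _) (hm _)).compl)

lemma card_filter_comp_perm {n : ℕ} (p : Fin n → Prop) [DecidablePred p] (σ : Equiv.Perm (Fin n)) :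
    Finset.card {i | p (σ i)} = Finset.card {i | p i} :=
  Finset.card_equiv σ (by simp)

open Classical in
/-- The number of indices satisfying a predicate. -/
noncomputable def countTrue {n : ℕ} (p : Fin n → Prop) : Fin (n + 1) :=
  ⟨Finset.card {i | p i}, Nat.lt_succ_of_le ((Finset.card_le_univ _).trans_eq (Fintype.card_fin n))⟩

lemma apply_le_iff_lt_countTrue {n : ℕ} (f : Fin n → ℝ) (c : ℝ) (j : Fin n) :
    f (Tuple.sort f j) ≤ c ↔ (j : ℕ) < countTrue fun i => f i ≤ c := by
  classical
  have h := Tuple.lt_card_le_iff_apply_le_of_monotone (f := f ∘ Tuple.sort f) (j := j) (a := c)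
    (Tuple.monotone_sort f)
  rw [← Function.comp_apply (f := f), ← h]
  simp only [Function.comp_apply]
  rw [card_filter_comp_perm (fun i => f i ≤ c) (Tuple.sort f), countTrue]

variable {μ : Measure ℝ} [IsProbabilityMeasure μ]

lemma ent_word_le_ent_orbitPattern_of_cut {T : ℝ → ℝ} (hT : Measurable T) {I : Type*} [Countable I]
    {Y : ℝ → I} (hY : FibreMeasurable Y) {F : Finset ℝ}
    (hF : ∀ x y, (∀ c ∈ F, x ≤ c ↔ y ≤ c) → Y x = Y y) (n : ℕ) :
    ent μ (word T Y n) ≤ ent μ (orbitPattern T n) + ENNReal.ofReal (F.card * log (n + 1)) := by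
  have hN : FibreMeasurable fun (ω : ℝ) (c : F) =>
      countTrue fun k : Fin n => T^[k] ω ≤ (c : ℝ) := by
    refine FibreMeasurable.pi fun c => ?_
    refine FibreMeasurable.comp_left (X := fun ω (k : Fin n) => T^[k] ω ≤ (c : ℝ)) ?_ countTrue
    exact FibreMeasurable.pi fun k =>
      fibreMeasurable_prop (measurableSet_le (hT.iterate _) measurable_const)
  have hpat := fibreMeasurable_orbitPattern hT n
  calc ent μ (word T Y n)
      ≤ ent μ fun ω => (orbitPattern T n ω, fun (c : F) =>
          countTrue fun k : Fin n => T^[k] ω ≤ (c : ℝ)) := by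
        refine ent_le_of_determines (G := Set.univ) (hY.word hT n) (hpat.prodMk hN) (by simp) ?_
        intro ω _ ω' _ h
        rw [Prod.mk.injEq] at h
        funext k
        refine hF _ _ fun c hc => ?_
        obtain ⟨j, rfl⟩ := (orbitPattern T n ω).surjective k
        have h1 := apply_le_iff_lt_countTrue (fun k : Fin n => T^[k] ω) c j
        have h2 := apply_le_iff_lt_countTrue (fun k : Fin n => T^[k] ω') c j
        have h3 := congrFun h.2 ⟨c, hc⟩
        simp only at h3
        rw [← h3] at h2
        refine h1.trans (h2.symm.trans ?_)
        rw [h.1]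
        rfl
    _ ≤ _ := ent_prodMk_le hpat hN
    _ ≤ _ := by
        gcongr
        refine (ent_le_log_card hN).trans_eq ?_
        simp [Fintype.card_pi]

lemma add_negMulLog_mono {p a : ℝ} (hp : 0 ≤ p) (hpa : p ≤ a) (ha : a ≤ 1) :
    p + negMulLog p ≤ a + negMulLog a := by
  rcases hp.eq_or_lt with rfl | hp'
  · simpa using add_nonneg hpa (negMulLog_nonneg hpa ha)
  have ha' := hp'.trans_le hpa
  have h1 := log_le_sub_one_of_pos (x := a / p) (by positivity)
  rw [log_div ha'.ne' hp'.ne'] at h1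
  have h2 := mul_le_mul_of_nonneg_left h1 hp
  have h3 : p * (a / p - 1) = a - p := by field_simp
  have h4 := log_nonpos ha'.le ha
  rw [h3] at h2
  rw [negMulLog, negMulLog]
  nlinarith

open Classical in
/-- The part of `X` that `Y` fails to predict. -/
noncomputable def mismatch {Ω I : Type*} (X Y : Ω → I) (ω : Ω) : Option I :=
  if X ω = Y ω then none else some (X ω)

lemma mismatch_preimage_some {Ω I : Type*} (X Y : Ω → I) (i : I) :
    mismatch X Y ⁻¹' {some i} = X ⁻¹' {i} ∩ (Y ⁻¹' {i})ᶜ := by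
  ext ω
  simp only [mismatch, Set.mem_preimage, Set.mem_singleton_iff, Set.mem_inter_iff,
    Set.mem_compl_iff]
  split_ifs with h
  · simp [h]
  · constructor
    · rintro h'
      rw [Option.some_inj] at h'
      exact ⟨h', fun h'' => h (h'.trans h''.symm)⟩
    · rintro ⟨rfl, -⟩; rfl

lemma fibreMeasurable_mismatch {Ω I : Type*} [MeasurableSpace Ω] [Countable I] {X Y : Ω → I}
    (hX : FibreMeasurable X) (hY : FibreMeasurable Y) : FibreMeasurable (mismatch X Y) := by
  classical
  exact FibreMeasurable.comp_left (hX.prodMk hY)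
    fun q : I × I => if q.1 = q.2 then none else some q.1

lemma ENNReal_tsum_option {I : Type*} (f : Option I → ℝ≥0∞) :
    ∑' i, f i = f none + ∑' i, f (some i) := by
  rw [← (Equiv.optionEquivSumPUnit.{0} I).symm.tsum_eq f,
    Summable.tsum_sum ENNReal.summable ENNReal.summable, add_comm]
  simp

lemma ent_mismatch_le {Ω I : Type*} [MeasurableSpace Ω] {ν : Measure Ω} [IsProbabilityMeasure ν]
    [Countable I] {X Y : Ω → I} (hX : FibreMeasurable X) (hY : FibreMeasurable Y) :
    ent ν (mismatch X Y) ≤ ∑' i, ENNReal.ofReal ((ν (X ⁻¹' {i} ∩ (Y ⁻¹' {i})ᶜ)).toReal +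
      negMulLog (ν (X ⁻¹' {i} ∩ (Y ⁻¹' {i})ᶜ)).toReal) := by
  have hZ := fibreMeasurable_mismatch hX hY
  have hsum : ν (mismatch X Y ⁻¹' {none}) + ∑' i, ν (mismatch X Y ⁻¹' {some i}) = 1 := by
    have := tsum_measure_inter_fibre (μ := ν) hZ MeasurableSet.univ
    rw [ENNReal_tsum_option] at this
    simpa using this
  rw [ent, ENNReal_tsum_option]
  simp_rw [← mismatch_preimage_some]
  have : ∀ i, ENNReal.ofReal ((ν (mismatch X Y ⁻¹' {some i})).toReal +
      negMulLog (ν (mismatch X Y ⁻¹' {some i})).toReal) = ν (mismatch X Y ⁻¹' {some i}) +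
      ENNReal.ofReal (negMulLog (ν (mismatch X Y ⁻¹' {some i})).toReal) := fun i => by
    rw [ENNReal.ofReal_add ENNReal.toReal_nonneg
      (negMulLog_nonneg ENNReal.toReal_nonneg measureReal_le_one),
      ENNReal.ofReal_toReal (measure_ne_top _ _)]
  simp_rw [this, ENNReal.tsum_add]
  gcongr
  have h0 : ν (mismatch X Y ⁻¹' {none}) ≤ 1 := prob_le_one
  have h1 : ∑' i, ν (mismatch X Y ⁻¹' {some i}) = 1 - ν (mismatch X Y ⁻¹' {none}) :=
    ENNReal.eq_sub_of_add_eq (measure_ne_top _ _) (by rw [add_comm, hsum])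
  rw [h1]
  refine ENNReal.ofReal_le_of_le_toReal ?_
  rw [ENNReal.toReal_sub_of_le h0 ENNReal.one_ne_top, ENNReal.toReal_one]
  generalize ν (mismatch X Y ⁻¹' {none}) = q at h0
  have hq : 0 ≤ q.toReal := ENNReal.toReal_nonneg
  have hq1 : q.toReal ≤ 1 := ENNReal.toReal_le_of_le_ofReal zero_le_one (by simpa using h0)
  simpa [add_comm, le_sub_iff_add_le] using add_negMulLog_mono hq hq1 le_rfl

/-- Any discrete random variable of finite entropy is approximated by ones that only depend on
the position relative to finitely many cut points. -/
lemma exists_cut_approx {X : ℝ → ℕ} (hX : FibreMeasurable X) (hfin : ent μ X ≠ ∞) {ε : ℝ}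
    (hε : 0 < ε) : ∃ (Y : ℝ → ℕ) (F : Finset ℝ), FibreMeasurable Y ∧
      (∀ x y, (∀ c ∈ F, x ≤ c ↔ y ≤ c) → Y x = Y y) ∧
      ent μ (mismatch X Y) ≤ ENNReal.ofReal ε := by
  classical
  have hB : ∀ m i : ℕ, ∃ B, IsCutSet B ∧
      μ ((X ⁻¹' {i}) ∆ B) < ENNReal.ofReal ((m + 1 : ℝ)⁻¹) := fun m i =>
    (measureDense_isCutSet μ).approx _ (hX i) (measure_ne_top _ _) _ (by positivity)
  choose B hBc hBμ using hB
  choose F hF using hBc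
  let Y : ℕ → ℝ → ℕ := fun m ω =>
    if h : ∃ i, i < m ∧ ω ∈ B m i then Nat.find h else m
  have hYF : ∀ m x y, (∀ c ∈ (Finset.range m).biUnion (F m), x ≤ c ↔ y ≤ c) → Y m x = Y m y := by
    intro m x y h
    have h1 : ∀ i, (i < m ∧ x ∈ B m i) ↔ (i < m ∧ y ∈ B m i) := fun i =>
      and_congr_right fun hi => hF m i x y fun c hc =>
        h c (Finset.mem_biUnion.2 ⟨i, Finset.mem_range.2 hi, hc⟩)
    simp only [Y, h1]
  have hYm : ∀ m, FibreMeasurable (Y m) := by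
    intro m i
    refine IsCutSet.measurableSet ⟨(Finset.range m).biUnion (F m), fun x y h => ?_⟩
    simp [hYF m x y h]
  let p : ℕ → ℕ → ℝ := fun m i => (μ (X ⁻¹' {i} ∩ (Y m ⁻¹' {i})ᶜ)).toReal
  let a : ℕ → ℝ := fun i => (μ (X ⁻¹' {i})).toReal
  have hp0 : ∀ m i, 0 ≤ p m i := fun m i => ENNReal.toReal_nonneg
  have hpa : ∀ m i, p m i ≤ a i := fun m i =>
    ENNReal.toReal_mono (measure_ne_top _ _) (measure_mono Set.inter_subset_left)
  have ha1 : ∀ i, a i ≤ 1 := fun i => measureReal_le_one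
  have hφ0 : ∀ m i, 0 ≤ p m i + negMulLog (p m i) := fun m i =>
    add_nonneg (hp0 m i) (negMulLog_nonneg (hp0 m i) ((hpa m i).trans (ha1 i)))
  have hφ : ∀ m i, p m i + negMulLog (p m i) ≤ a i + negMulLog (a i) := fun m i =>
    add_negMulLog_mono (hp0 m i) (hpa m i) (ha1 i)
  have hsum : Summable fun i => a i + negMulLog (a i) := by
    refine Summable.add (ENNReal.summable_toReal ?_) ?_
    · have := tsum_measure_inter_fibre (μ := μ) hX MeasurableSet.univ
      simp only [Set.univ_inter, measure_univ] at this
      rw [this]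
      exact ENNReal.one_ne_top
    · refine (ENNReal.summable_toReal hfin).congr fun i => ?_
      exact ENNReal.toReal_ofReal (negMulLog_nonneg ENNReal.toReal_nonneg (ha1 i))
  have hple : ∀ i m, i < m → p m i ≤ (i + 1) * (m + 1 : ℝ)⁻¹ := by
    intro i m him
    have hsub : X ⁻¹' {i} ∩ (Y m ⁻¹' {i})ᶜ ⊆
        ⋃ j ∈ Finset.range (i + 1), (X ⁻¹' {j}) ∆ B m j := by
      rintro ω ⟨h1, h2⟩
      simp only [Set.mem_preimage, Set.mem_singleton_iff, Set.mem_compl_iff] at h1 h2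
      simp only [Set.mem_iUnion, Finset.mem_range]
      by_cases hω : ω ∈ B m i
      · have hex : ∃ i, i < m ∧ ω ∈ B m i := ⟨i, him, hω⟩
        have hYω : Y m ω = Nat.find hex := dif_pos hex
        rw [hYω] at h2
        have hle : Nat.find hex ≤ i := Nat.find_min' hex ⟨him, hω⟩
        refine ⟨Nat.find hex, by omega, Or.inr ⟨(Nat.find_spec hex).2, ?_⟩⟩
        simp only [Set.mem_preimage, Set.mem_singleton_iff]
        omega
      · exact ⟨i, by omega, Or.inl ⟨h1, hω⟩⟩
    have : μ (X ⁻¹' {i} ∩ (Y m ⁻¹' {i})ᶜ) ≤ ENNReal.ofReal ((i + 1) * (m + 1 : ℝ)⁻¹) := by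
      calc _ ≤ _ := measure_mono hsub
        _ ≤ _ := measure_biUnion_finset_le _ _
        _ ≤ ∑ j ∈ Finset.range (i + 1), ENNReal.ofReal ((m + 1 : ℝ)⁻¹) :=
          Finset.sum_le_sum fun j _ => (hBμ m j).le
        _ = _ := by
          rw [Finset.sum_const, Finset.card_range, nsmul_eq_mul,
            ENNReal.ofReal_mul (by positivity)]
          congr 1
          rw [← ENNReal.ofReal_natCast]
          push_cast
          rfl
    exact ENNReal.toReal_le_of_le_ofReal (by positivity) this
  have hplim : ∀ i, Tendsto (fun m => p m i) atTop (nhds 0) := by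
    intro i
    have h1 : Tendsto (fun m : ℕ => ((i : ℝ) + 1) * (m + 1 : ℝ)⁻¹) atTop (nhds 0) := by
      simpa [one_div] using (tendsto_one_div_add_atTop_nhds_zero_nat (𝕜 := ℝ)).const_mul
        ((i : ℝ) + 1)
    exact tendsto_of_tendsto_of_tendsto_of_le_of_le' tendsto_const_nhds h1
      (Eventually.of_forall fun m => hp0 m i)
      (by filter_upwards [eventually_gt_atTop i] with m hm using hple i m hm)
  have hlim : Tendsto (fun m => ∑' i, (p m i + negMulLog (p m i))) atTop (nhds 0) := by
    have := tendsto_tsum_of_dominated_convergence (𝓕 := atTop)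
      (f := fun m i => p m i + negMulLog (p m i)) (g := fun _ => (0 : ℝ)) hsum
      (fun i => ?_) (Eventually.of_forall fun m i => ?_)
    · simpa using this
    · have h1 := (hplim i).add ((continuous_negMulLog.tendsto 0).comp (hplim i))
      simpa using h1
    · rw [Real.norm_of_nonneg (hφ0 m i)]
      exact hφ m i
  obtain ⟨m, hm⟩ := (hlim.eventually_lt_const hε).exists
  refine ⟨Y m, _, hYm m, hYF m, (ent_mismatch_le hX (hYm m)).trans ?_⟩
  have hs : Summable fun i => p m i + negMulLog (p m i) :=
    Summable.of_nonneg_of_le (hφ0 m) (hφ m) hsum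
  rw [← ENNReal.ofReal_tsum_of_nonneg (hφ0 m) hs]
  exact ENNReal.ofReal_le_ofReal hm.le

/-- Order patterns asymptotically carry all the entropy of any partition. -/
lemma exists_ent_word_le_ent_orbitPattern {T : ℝ → ℝ} (hT : MeasurePreserving T μ μ) {X : ℝ → ℕ}
    (hX : FibreMeasurable X) (hfin : ent μ X ≠ ∞) {ε : ℝ} (hε : 0 < ε) :
    ∃ C : ℕ, ∀ n : ℕ, ent μ (word T X n) ≤
      ent μ (orbitPattern T n) + ENNReal.ofReal (C * log (n + 1) + n * ε) := by
  obtain ⟨Y, F, hY, hF, hle⟩ := exists_cut_approx hX hfin hε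
  refine ⟨F.card, fun n => ?_⟩
  have hZ := fibreMeasurable_mismatch hX hY
  calc ent μ (word T X n)
      ≤ ent μ fun ω => (word T Y n ω, word T (mismatch X Y) n ω) := by
        refine ent_le_of_determines (G := Set.univ) (hX.word hT.measurable n)
          ((hY.word hT.measurable n).prodMk (hZ.word hT.measurable n)) (by simp) ?_
        intro ω _ ω' _ h
        rw [Prod.mk.injEq] at h
        funext k
        have h1 : Y (T^[k] ω) = Y (T^[k] ω') := congrFun h.1 k
        have h2 : mismatch X Y (T^[k] ω) = mismatch X Y (T^[k] ω') := congrFun h.2 k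
        change X (T^[k] ω) = X (T^[k] ω')
        unfold mismatch at h2
        split_ifs at h2 with h3 h4
        · rw [h3, h4, h1]
        · exact Option.some_inj.1 h2
    _ ≤ ent μ (word T Y n) + ent μ (word T (mismatch X Y) n) :=
        ent_prodMk_le (hY.word hT.measurable n) (hZ.word hT.measurable n)
    _ ≤ (ent μ (orbitPattern T n) + ENNReal.ofReal (F.card * log (n + 1))) +
        n * ENNReal.ofReal ε := by
        gcongr
        · exact ent_word_le_ent_orbitPattern_of_cut hT.measurable hY hF n
        · exact (ent_word_le hT hZ n).trans (by gcongr)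
    _ = _ := by
        rw [ENNReal.ofReal_add (mul_nonneg (by positivity) (log_nonneg (by simp))) (by positivity),
          ENNReal.ofReal_mul (p := (n : ℝ)) (by positivity), ENNReal.ofReal_natCast, add_assoc]

end OrderPatterns

section GaussMeasure

lemma gaussMap_eq_fract (ω : ℝ) : gaussMap ω = Int.fract ω⁻¹ := by
  unfold gaussMap
  split_ifs with h <;> simp [h]

lemma measurable_gaussMap : Measurable gaussMap := by
  rw [funext gaussMap_eq_fract]
  exact measurable_fract.comp measurable_inv

lemma gaussMeasure_absolutelyContinuous : gaussMeasure ≪ volume :=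
  (withDensity_absolutelyContinuous _ _).trans Measure.restrict_le_self.absolutelyContinuous

lemma gaussMeasure_Icc {b c : ℝ} (hb : 0 ≤ b) (hbc : b ≤ c) (hc : c ≤ 1) :
    gaussMeasure (Set.Icc b c) = ENNReal.ofReal ((log (1 + c) - log (1 + b)) / log 2) := by
  have hpos : ∀ x ∈ Set.uIcc b c, 0 < 1 + x := fun x hx => by
    rw [Set.uIcc_of_le hbc] at hx
    linarith [hx.1]
  have hcont : ContinuousOn (fun x : ℝ => (log 2)⁻¹ * (1 + x)⁻¹) (Set.uIcc b c) :=
    continuousOn_const.mul ((continuousOn_const.add continuousOn_id).inv₀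
      fun x hx => (hpos x hx).ne')
  have hint : ∫ x in b..c, (log 2)⁻¹ * (1 + x)⁻¹ =
      (log 2)⁻¹ * log (1 + c) - (log 2)⁻¹ * log (1 + b) := by
    refine intervalIntegral.integral_eq_sub_of_hasDerivAt
      (f := fun x => (log 2)⁻¹ * log (1 + x)) (fun x hx => ?_) hcont.intervalIntegrable
    have := (((hasDerivAt_id x).const_add 1).log (hpos x hx).ne').const_mul (log 2)⁻¹
    simpa using this
  rw [gaussMeasure, withDensity_apply _ measurableSet_Icc,
    Measure.restrict_restrict measurableSet_Icc,
    Set.inter_eq_left.2 (Set.Icc_subset_Icc hb hc),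
    ← ofReal_integral_eq_lintegral_ofReal]
  · rw [integral_Icc_eq_integral_Ioc, ← intervalIntegral.integral_of_le hbc, hint]
    congr 1
    ring
  · have := hcont.integrableOn_compact isCompact_uIcc (μ := volume)
    rwa [Set.uIcc_of_le hbc] at this
  · filter_upwards [ae_restrict_mem measurableSet_Icc] with x hx
    have := hpos x (by rwa [Set.uIcc_of_le hbc])
    have := log_nonneg (x := 2) (by norm_num)
    positivity

lemma ae_mem_Icc : ∀ᵐ ω ∂gaussMeasure, ω ∈ Set.Icc (0 : ℝ) 1 :=
  (withDensity_absolutelyContinuous _ _).ae_le (ae_restrict_mem measurableSet_Icc)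

instance isProbabilityMeasure_gaussMeasure : IsProbabilityMeasure gaussMeasure where
  measure_univ := by
    have h : gaussMeasure (Set.Icc 0 1) = gaussMeasure Set.univ :=
      measure_congr (eventuallyEq_univ.2 ae_mem_Icc)
    rw [← h, gaussMeasure_Icc le_rfl zero_le_one le_rfl]
    have : log 2 ≠ 0 := (log_pos (by norm_num)).ne'
    norm_num [this]

lemma ae_mem_Ioo : ∀ᵐ ω ∂gaussMeasure, ω ∈ Set.Ioo (0 : ℝ) 1 := by
  have h0 : ∀ c : ℝ, ∀ᵐ ω ∂gaussMeasure, ω ≠ c := fun c =>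
    gaussMeasure_absolutelyContinuous.ae_le (Measure.ae_ne volume c)
  filter_upwards [ae_mem_Icc, h0 0, h0 1] with ω h1 h2 h3
  exact ⟨lt_of_le_of_ne h1.1 (Ne.symm h2), lt_of_le_of_ne h1.2 h3⟩

lemma mem_branch_iff {a ω : ℝ} (ha : 0 ≤ a) (hω : 0 < ω) (n : ℕ) :
    ω ∈ Set.Icc (n + 1 + a)⁻¹ (n + 1 : ℝ)⁻¹ ↔ (n : ℝ) + 1 ≤ ω⁻¹ ∧ ω⁻¹ ≤ n + 1 + a := by
  rw [Set.mem_Icc, inv_le_comm₀ (by positivity) hω, le_inv_comm₀ hω (by positivity), and_comm]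

lemma floor_inv_of_mem_branch {a ω : ℝ} (ha : 0 ≤ a) (ha1 : a < 1) {n : ℕ}
    (h : ω ∈ Set.Icc (n + 1 + a)⁻¹ (n + 1 : ℝ)⁻¹) : ⌊ω⁻¹⌋ = n + 1 := by
  have hω : 0 < ω := lt_of_lt_of_le (by positivity) h.1
  rw [mem_branch_iff ha hω] at h
  rw [Int.floor_eq_iff]
  push_cast
  exact ⟨h.1, by linarith [h.2]⟩

lemma gaussMap_le_iff {a ω : ℝ} (ha : 0 ≤ a) (ha1 : a < 1) (hω : ω ∈ Set.Ioo (0 : ℝ) 1) :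
    gaussMap ω ≤ a ↔ ∃ n : ℕ, ω ∈ Set.Icc (n + 1 + a)⁻¹ (n + 1 : ℝ)⁻¹ := by
  rw [gaussMap_eq_fract]
  constructor
  · intro h
    have h1 : 1 ≤ ⌊ω⁻¹⌋ := Int.le_floor.2 (by simpa using (one_le_inv₀ hω.1).2 hω.2.le)
    obtain ⟨n, hn⟩ := Int.eq_ofNat_of_zero_le (sub_nonneg.2 h1)
    have h2 : (⌊ω⁻¹⌋ : ℝ) = n + 1 := by
      have : ⌊ω⁻¹⌋ = (n : ℤ) + 1 := by omega
      rw [this]; push_cast; ring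
    refine ⟨n, (mem_branch_iff ha hω.1 n).2 ?_⟩
    rw [Int.fract, h2] at h
    exact ⟨h2 ▸ Int.floor_le _, by linarith⟩
  · rintro ⟨n, hn⟩
    have h1 := floor_inv_of_mem_branch ha ha1 hn
    rw [mem_branch_iff ha hω.1] at hn
    rw [Int.fract, h1]
    push_cast
    linarith [hn.2]

lemma hasSum_gaussMeasure_branch {a : ℝ} (ha : 0 ≤ a) :
    HasSum (fun n : ℕ => (log (1 + (n + 1 : ℝ)⁻¹) - log (1 + (n + 1 + a)⁻¹)) / log 2)
      (log (1 + a) / log 2) := by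
  have hl2 : 0 < log 2 := log_pos (by norm_num)
  let g : ℕ → ℝ := fun n => log (1 + a * (n + 1 : ℝ)⁻¹) / log 2
  have hg : ∀ n : ℕ, (log (1 + (n + 1 : ℝ)⁻¹) - log (1 + (n + 1 + a)⁻¹)) / log 2 =
      g n - g (n + 1) := by
    intro n
    have hn : (0 : ℝ) < n + 1 := by positivity
    have e1 : 1 + (n + 1 : ℝ)⁻¹ = (n + 2) / (n + 1) := by field_simp; ring
    have e2 : 1 + (n + 1 + a : ℝ)⁻¹ = (n + 2 + a) / (n + 1 + a) := by field_simp; ring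
    have e3 : 1 + a * (n + 1 : ℝ)⁻¹ = (n + 1 + a) / (n + 1) := by field_simp
    have e4 : 1 + a * ((n + 1 : ℕ) + 1 : ℝ)⁻¹ = (n + 2 + a) / (n + 2) := by
      push_cast; field_simp; ring
    simp only [g]
    rw [e1, e2, e3, e4, log_div (by positivity) (by positivity),
      log_div (by positivity) (by positivity), log_div (by positivity) (by positivity),
      log_div (by positivity) (by positivity)]
    ring
  rw [hasSum_iff_tendsto_nat_of_nonneg]
  · simp_rw [hg, Finset.sum_range_sub']
    have h0 : g 0 = log (1 + a) / log 2 := by simp [g]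
    have hlim : Tendsto g atTop (nhds 0) := by
      have h1 : Tendsto (fun n : ℕ => 1 + a * (n + 1 : ℝ)⁻¹) atTop (nhds 1) := by
        simpa [one_div] using
          ((tendsto_one_div_add_atTop_nhds_zero_nat (𝕜 := ℝ)).const_mul a).const_add 1
      simpa using (h1.log one_ne_zero).div_const (log 2)
    simpa [h0] using hlim.const_sub (g 0)
  · intro n
    refine div_nonneg (sub_nonneg.2 (log_le_log (by positivity) ?_)) hl2.le
    have : (n + 1 + a : ℝ)⁻¹ ≤ (n + 1 : ℝ)⁻¹ := inv_anti₀ (by positivity) (by linarith)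
    linarith

lemma measurePreserving_gaussMap : MeasurePreserving gaussMap gaussMeasure gaussMeasure := by
  refine ⟨measurable_gaussMap, ?_⟩
  have : IsProbabilityMeasure (gaussMeasure.map gaussMap) :=
    Measure.isProbabilityMeasure_map measurable_gaussMap.aemeasurable
  refine Measure.ext_of_Iic _ _ fun a => ?_
  rw [Measure.map_apply measurable_gaussMap measurableSet_Iic]
  rcases lt_or_ge a 0 with ha | ha
  · rw [measure_eq_zero_iff_ae_notMem.2, measure_eq_zero_iff_ae_notMem.2]
    · filter_upwards [ae_mem_Icc] with ω hω h
      exact absurd (hω.1.trans h) (not_le.2 ha)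
    · refine Eventually.of_forall fun ω h => ?_
      rw [Set.mem_preimage, Set.mem_Iic, gaussMap_eq_fract] at h
      exact absurd ((Int.fract_nonneg _).trans h) (not_le.2 ha)
  rcases lt_or_ge a 1 with ha1 | ha1
  · have h1 : gaussMeasure (gaussMap ⁻¹' Set.Iic a) =
        gaussMeasure (⋃ n : ℕ, Set.Icc (n + 1 + a)⁻¹ (n + 1 : ℝ)⁻¹) := by
      refine measure_congr ?_
      filter_upwards [ae_mem_Ioo] with ω hω
      exact propext ((gaussMap_le_iff ha ha1 hω).trans Set.mem_iUnion.symm)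
    have h2 : gaussMeasure (Set.Iic a) = gaussMeasure (Set.Icc 0 a) := by
      refine measure_congr ?_
      filter_upwards [ae_mem_Icc] with ω hω
      exact propext ⟨fun h => ⟨hω.1, h⟩, fun h => h.2⟩
    have hnn : ∀ n : ℕ, (n + 1 + a : ℝ)⁻¹ ≤ (n + 1 : ℝ)⁻¹ := fun n =>
      inv_anti₀ (by positivity) (by linarith)
    rw [h1, h2, gaussMeasure_Icc le_rfl ha ha1.le, measure_iUnion _ fun n => measurableSet_Icc]
    · have hs := hasSum_gaussMeasure_branch ha
      have h3 : ∀ n : ℕ, gaussMeasure (Set.Icc (n + 1 + a)⁻¹ (n + 1 : ℝ)⁻¹) = ENNReal.ofReal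
          ((log (1 + (n + 1 : ℝ)⁻¹) - log (1 + (n + 1 + a)⁻¹)) / log 2) := fun n =>
        gaussMeasure_Icc (by positivity) (hnn n) (inv_le_one_of_one_le₀ (by simp))
      simp_rw [h3]
      rw [← ENNReal.ofReal_tsum_of_nonneg _ hs.summable, hs.tsum_eq]
      · simp
      · intro n
        refine div_nonneg (sub_nonneg.2 (log_le_log (by positivity) ?_))
          (log_nonneg (by norm_num))
        linarith [hnn n]
    · intro m n hmn
      refine Set.disjoint_left.2 fun ω hm hn => hmn ?_
      have e1 := floor_inv_of_mem_branch ha ha1 hm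
      have e2 := floor_inv_of_mem_branch ha ha1 hn
      omega
  · refine measure_congr ?_
    filter_upwards [ae_mem_Icc] with ω hω
    refine propext ⟨fun _ => hω.2.trans ha1, fun _ => ?_⟩
    change gaussMap ω ≤ a
    rw [gaussMap_eq_fract]
    exact (Int.fract_lt_one _).le.trans ha1

end GaussMeasure

section GaussDigits

/-- The first continued fraction digit. -/
noncomputable def gaussDigit (x : ℝ) : ℕ := ⌊x⁻¹⌋₊

lemma fibreMeasurable_gaussDigit : FibreMeasurable gaussDigit := fun i =>
  (Nat.measurable_floor.comp measurable_inv) (measurableSet_singleton i)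

lemma gaussMap_eq_sub_digit {x : ℝ} (hx : 0 < x) : gaussMap x = x⁻¹ - gaussDigit x := by
  rw [gaussMap_eq_fract, Int.fract, gaussDigit, natCast_floor_eq_intCast_floor (by positivity)]

lemma lt_of_gaussDigit_lt {x y : ℝ} (hy : 0 < y) (h : gaussDigit y < gaussDigit x) : x < y := by
  by_contra! hcon
  exact absurd (Nat.floor_mono (inv_anti₀ hy hcon)) (not_le.2 h)

lemma gaussMap_lt_iff {x y : ℝ} (hx : 0 < x) (hy : 0 < y) (h : gaussDigit x = gaussDigit y) :
    gaussMap y < gaussMap x ↔ x < y := by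
  rw [gaussMap_eq_sub_digit hx, gaussMap_eq_sub_digit hy, h, sub_lt_sub_iff_right,
    inv_lt_inv₀ hy hx]

lemma dist_lt_dist_gaussMap {x y : ℝ} (hx : x ∈ Set.Ioo (0 : ℝ) 1) (hy : y ∈ Set.Ioo (0 : ℝ) 1)
    (h : gaussDigit x = gaussDigit y) (hxy : x ≠ y) :
    |x - y| < |gaussMap x - gaussMap y| := by
  obtain ⟨hx0, hx1⟩ := hx
  obtain ⟨hy0, hy1⟩ := hy
  have hd : 0 < |x - y| := abs_pos.2 (sub_ne_zero.2 hxy)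
  rw [gaussMap_eq_sub_digit hx0, gaussMap_eq_sub_digit hy0, h, sub_sub_sub_cancel_right,
    inv_sub_inv hx0.ne' hy0.ne', abs_div, abs_sub_comm y x, abs_of_pos (mul_pos hx0 hy0)]
  rw [lt_div_iff₀ (mul_pos hx0 hy0)]
  exact mul_lt_of_lt_one_right hd (by nlinarith)

/-- The points whose whole orbit stays in the open unit interval. -/
def GaussRegular (x : ℝ) : Prop := ∀ k : ℕ, gaussMap^[k] x ∈ Set.Ioo (0 : ℝ) 1

lemma GaussRegular.iterate {x : ℝ} (hx : GaussRegular x) (k : ℕ) :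
    GaussRegular (gaussMap^[k] x) := fun l => by
  rw [← Function.iterate_add_apply]
  exact hx _

lemma GaussRegular.dist_le {x y : ℝ} (hx : GaussRegular x) (hy : GaussRegular y) {m : ℕ}
    (h : ∀ k < m, gaussDigit (gaussMap^[k] x) = gaussDigit (gaussMap^[k] y)) :
    |x - y| ≤ |gaussMap^[m] x - gaussMap^[m] y| := by
  induction m with
  | zero => simp
  | succ m ih =>
    refine (ih fun k hk => h k (by omega)).trans ?_
    rw [Function.iterate_succ_apply', Function.iterate_succ_apply']
    by_cases hxy : gaussMap^[m] x = gaussMap^[m] y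
    · simp [hxy]
    · exact (dist_lt_dist_gaussMap (hx m) (hy m) (h m (by omega)) hxy).le

lemma countable_gaussRegular_periodic (m : ℕ) :
    {x | GaussRegular x ∧ gaussMap^[m + 1] x = x}.Countable := by
  refine Set.countable_of_injective_of_countable_image (f := word gaussMap gaussDigit (m + 1)) ?_
    (Set.to_countable _)
  rintro x ⟨hx, hxm⟩ y ⟨hy, hym⟩ hxy
  by_contra hne
  have hd : ∀ k < m + 1, gaussDigit (gaussMap^[k] x) = gaussDigit (gaussMap^[k] y) :=
    fun k hk => congrFun hxy ⟨k, hk⟩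
  have h1 := dist_lt_dist_gaussMap (hx 0) (hy 0) (hd 0 (by omega)) hne
  have h2 := (hx.iterate 1).dist_le (hy.iterate 1) (m := m) fun k hk => by
    simpa only [← Function.iterate_add_apply] using hd (k + 1) (by omega)
  rw [← Function.iterate_add_apply, ← Function.iterate_add_apply, hxm, hym] at h2
  exact absurd h2 (not_le.2 h1)

lemma ae_gaussRegular : ∀ᵐ ω ∂gaussMeasure, GaussRegular ω :=
  ae_all_iff.2 fun k => (measurePreserving_gaussMap.iterate k).quasiMeasurePreserving.ae ae_mem_Ioo

lemma ae_injective_orbit :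
    ∀ᵐ ω ∂gaussMeasure, Function.Injective fun k : ℕ => gaussMap^[k] ω := by
  have h : ∀ᵐ ω ∂gaussMeasure, ∀ k m : ℕ,
      ¬ (GaussRegular (gaussMap^[k] ω) ∧ gaussMap^[m + 1] (gaussMap^[k] ω) = gaussMap^[k] ω) := by
    refine ae_all_iff.2 fun k => ae_all_iff.2 fun m => ?_
    refine (measurePreserving_gaussMap.iterate k).quasiMeasurePreserving.ae
      (p := fun x => ¬ (GaussRegular x ∧ gaussMap^[m + 1] x = x)) ?_
    exact measure_eq_zero_iff_ae_notMem.1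
      (gaussMeasure_absolutelyContinuous ((countable_gaussRegular_periodic m).measure_zero _))
  filter_upwards [h, ae_gaussRegular] with ω hω hreg
  refine Function.Injective.of_lt_imp_ne fun k l hkl heq => ?_
  obtain ⟨m, rfl⟩ := Nat.exists_eq_add_of_lt hkl
  refine hω k m ⟨hreg.iterate k, ?_⟩
  rw [← Function.iterate_add_apply, show m + 1 + k = k + m + 1 by ring]
  exact heq.symm

lemma sort_eq_of_lt_iff {n : ℕ} {f g : Fin n → ℝ} (h : ∀ i j, f i < f j ↔ g i < g j) :
    Tuple.sort f = Tuple.sort g := by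
  obtain ⟨h1, h2⟩ := Tuple.eq_sort_iff.1 (rfl : Tuple.sort f = Tuple.sort f)
  refine Tuple.eq_sort_iff.2 ⟨fun i j hij => ?_, fun i j hij heq => h2 i j hij ?_⟩
  · exact not_lt.1 fun hlt => absurd ((h _ _).2 hlt) (not_lt.2 (h1 hij))
  · exact le_antisymm (not_lt.1 fun hlt => absurd ((h _ _).1 hlt) heq.not_gt)
      (not_lt.1 fun hlt => absurd ((h _ _).1 hlt) heq.not_lt)

lemma forall_lt_iff_of_countTrue_eq {n : ℕ} {p q : Fin n → Prop} (h : countTrue p = countTrue q)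
    (hpq : ∀ i, p i → q i) (i : Fin n) : p i ↔ q i := by
  classical
  have hcard : Finset.card {i | q i} ≤ Finset.card {i | p i} := by
    have := congrArg Fin.val h
    simp only [countTrue] at this
    convert this.ge
  have heq := Finset.eq_of_subset_of_card_le
    (Finset.monotone_filter_right Finset.univ fun i _ => hpq i) hcard
  simpa using Finset.ext_iff.1 heq i

/-- The number of points of an orbit segment lying below the last one. -/
noncomputable def lastRank (T : ℝ → ℝ) (N : ℕ) (ω : ℝ) : Fin (N + 1 + 1) :=
  countTrue fun k : Fin (N + 1) => T^[k] ω < T^[N] ω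

lemma fibreMeasurable_lastRank {T : ℝ → ℝ} (hT : Measurable T) (N : ℕ) :
    FibreMeasurable (lastRank T N) := by
  refine FibreMeasurable.comp_left (X := fun ω (k : Fin (N + 1)) => T^[k] ω < T^[N] ω) ?_ countTrue
  exact FibreMeasurable.pi fun k =>
    fibreMeasurable_prop (measurableSet_lt (hT.iterate _) (hT.iterate _))

lemma lt_last_iff {ω ω' : ℝ} {N : ℕ} (hω : GaussRegular ω) (hω' : GaussRegular ω')
    (hd : ∀ k < N, gaussDigit (gaussMap^[k] ω) = gaussDigit (gaussMap^[k] ω'))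
    (hr : lastRank gaussMap N ω = lastRank gaussMap N ω') {i : ℕ} (hi : i ≤ N) :
    gaussMap^[i] ω < gaussMap^[N] ω ↔ gaussMap^[i] ω' < gaussMap^[N] ω' := by
  wlog hle : gaussMap^[N] ω ≤ gaussMap^[N] ω' generalizing ω ω'
  · exact (this hω' hω (fun k hk => (hd k hk).symm) hr.symm (le_of_not_ge hle)).symm
  have hcontr : ∀ k ≤ N, |gaussMap^[k] ω - gaussMap^[k] ω'| ≤
      |gaussMap^[N] ω - gaussMap^[N] ω'| := by
    intro k hk
    have := (hω.iterate k).dist_le (hω'.iterate k) (m := N - k) fun l hl => by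
      simpa only [← Function.iterate_add_apply] using hd (l + k) (by omega)
    simpa only [← Function.iterate_add_apply, Nat.sub_add_cancel hk] using this
  refine forall_lt_iff_of_countTrue_eq hr (fun k hk => ?_) ⟨i, by omega⟩
  have h1 := hcontr k (by omega)
  rw [abs_sub_comm (gaussMap^[N] ω), abs_of_nonneg (sub_nonneg.2 hle)] at h1
  have h2 := neg_le_of_abs_le h1
  linarith

lemma orbit_lt_iff {ω ω' : ℝ} {N : ℕ} (hω : GaussRegular ω) (hω' : GaussRegular ω')
    (hinj : Function.Injective fun k : ℕ => gaussMap^[k] ω)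
    (hinj' : Function.Injective fun k : ℕ => gaussMap^[k] ω')
    (hd : ∀ k < N, gaussDigit (gaussMap^[k] ω) = gaussDigit (gaussMap^[k] ω'))
    (hr : lastRank gaussMap N ω = lastRank gaussMap N ω') (m : ℕ) :
    ∀ i j : ℕ, max i j + m = N →
      (gaussMap^[i] ω < gaussMap^[j] ω ↔ gaussMap^[i] ω' < gaussMap^[j] ω') := by
  induction m with
  | zero =>
    intro i j hij
    have hlast : ∀ i ≤ N, (gaussMap^[i] ω < gaussMap^[N] ω ↔ gaussMap^[i] ω' < gaussMap^[N] ω') :=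
      fun i hi => lt_last_iff hω hω' hd hr hi
    rcases eq_or_ne i j with rfl | hne
    · simp
    rcases le_total i j with h | h
    · obtain rfl : j = N := by omega
      exact hlast i h
    · obtain rfl : i = N := by omega
      have h1 := hlast j h
      rw [← not_iff_not, not_lt, not_lt, le_iff_lt_or_eq, le_iff_lt_or_eq,
        or_iff_left (hinj.ne hne.symm), or_iff_left (hinj'.ne hne.symm)]
      exact h1
  | succ m ih =>
    intro i j hij
    have hi := hd i (by omega)
    have hj := hd j (by omega)
    rcases lt_trichotomy (gaussDigit (gaussMap^[i] ω)) (gaussDigit (gaussMap^[j] ω)) with h | h | h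
    · exact iff_of_false (lt_of_gaussDigit_lt (hω i).1 h).not_gt
        (lt_of_gaussDigit_lt (hω' i).1 (hi ▸ hj ▸ h)).not_gt
    · rw [← gaussMap_lt_iff (hω i).1 (hω j).1 h, ← gaussMap_lt_iff (hω' i).1 (hω' j).1
        (hi.symm.trans (h.trans hj)), ← Function.iterate_succ_apply' gaussMap,
        ← Function.iterate_succ_apply' gaussMap, ← Function.iterate_succ_apply' gaussMap,
        ← Function.iterate_succ_apply' gaussMap]
      exact ih _ _ (by omega)
    · exact iff_of_true (lt_of_gaussDigit_lt (hω j).1 h)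
        (lt_of_gaussDigit_lt (hω' j).1 (hi ▸ hj ▸ h))

lemma ent_orbitPattern_gaussMap_le (N : ℕ) :
    ent gaussMeasure (orbitPattern gaussMap (N + 1)) ≤
      ent gaussMeasure (word gaussMap gaussDigit (N + 1)) +
        ENNReal.ofReal (log ((N + 1 : ℕ) + 1)) := by
  have hw := fibreMeasurable_gaussDigit.word measurable_gaussMap (N + 1)
  have hr := fibreMeasurable_lastRank measurable_gaussMap N
  calc ent gaussMeasure (orbitPattern gaussMap (N + 1))
      ≤ ent gaussMeasure fun ω =>
          (word gaussMap gaussDigit (N + 1) ω, lastRank gaussMap N ω) := by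
        refine ent_le_of_determines (fibreMeasurable_orbitPattern measurable_gaussMap _)
          (hw.prodMk hr) (ae_gaussRegular.and ae_injective_orbit) ?_
        rintro ω ⟨hω, hinj⟩ ω' ⟨hω', hinj'⟩ h
        rw [Prod.mk.injEq] at h
        refine sort_eq_of_lt_iff fun i j => ?_
        exact orbit_lt_iff hω hω' hinj hinj'
          (fun k hk => congrFun h.1 ⟨k, by omega⟩) h.2 (N - max (i : ℕ) j) _ _ (by omega)
    _ ≤ _ := ent_prodMk_le hw hr
    _ ≤ _ := by
        gcongr
        refine (ent_le_log_card hr).trans_eq ?_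
        simp

lemma negMulLog_le_rpow {p : ℝ} (hp : 0 ≤ p) : negMulLog p ≤ 3 * p ^ (2 / 3 : ℝ) := by
  rcases hp.eq_or_lt with rfl | hp'
  · simp
  have h1 := log_le_rpow_div (x := p⁻¹) (by positivity) (ε := 1 / 3) (by norm_num)
  have h2 : p * p⁻¹ ^ (1 / 3 : ℝ) = p ^ (2 / 3 : ℝ) := by
    rw [inv_rpow hp, ← rpow_neg hp, mul_comm, ← rpow_add_one hp'.ne']
    norm_num
  rw [log_inv] at h1
  have h3 := mul_le_mul_of_nonneg_left h1 hp
  rw [← mul_div_assoc, h2] at h3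
  rw [negMulLog]
  linarith

lemma gaussMeasure_gaussDigit_le (i : ℕ) :
    (gaussMeasure (gaussDigit ⁻¹' {i})).toReal ≤ 2 * (i : ℝ) ^ (-2 : ℝ) := by
  rcases Nat.eq_zero_or_pos i with rfl | hi
  · have : gaussMeasure (gaussDigit ⁻¹' {0}) = 0 := by
      rw [measure_eq_zero_iff_ae_notMem]
      filter_upwards [ae_mem_Ioo] with ω hω h
      have h1 : 1 ≤ gaussDigit ω := (Nat.one_le_floor_iff _).2 ((one_le_inv₀ hω.1).2 hω.2.le)
      rw [Set.mem_preimage, Set.mem_singleton_iff] at h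
      omega
    simp [this]
  have hi' : (0 : ℝ) < i := by exact_mod_cast hi
  have hi1 : (1 : ℝ) ≤ i := by exact_mod_cast hi
  have hle : (i + 1 : ℝ)⁻¹ ≤ (i : ℝ)⁻¹ := inv_anti₀ hi' (by linarith)
  have h1 : gaussMeasure (gaussDigit ⁻¹' {i}) ≤
      ENNReal.ofReal ((log (1 + (i : ℝ)⁻¹) - log (1 + (i + 1 : ℝ)⁻¹)) / log 2) := by
    rw [← gaussMeasure_Icc (by positivity) hle (inv_le_one_of_one_le₀ hi1)]
    refine measure_mono_ae ?_
    filter_upwards [ae_mem_Ioo] with ω hω h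
    have h2 : ⌊ω⁻¹⌋₊ = i := h
    rw [Nat.floor_eq_iff (inv_nonneg.2 hω.1.le)] at h2
    exact ⟨inv_le_of_inv_le₀ hω.1 h2.2.le, le_inv_of_le_inv₀ hi' h2.1⟩
  refine (ENNReal.toReal_le_of_le_ofReal ?_ h1).trans ?_
  · exact div_nonneg (sub_nonneg.2 (log_le_log (by positivity) (by linarith)))
      (log_nonneg (by norm_num))
  have hl2 : 1 / 2 < log 2 := by linarith [log_two_gt_d9]
  rw [div_le_iff₀ (by linarith), ← log_div (by positivity) (by positivity)]
  refine (log_le_sub_one_of_pos (by positivity)).trans ?_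
  have h3 : (1 + (i : ℝ)⁻¹) / (1 + (i + 1 : ℝ)⁻¹) - 1 = (i * (i + 2) : ℝ)⁻¹ := by
    field_simp
    ring
  have h4 : (i : ℝ) ^ (-2 : ℝ) = ((i : ℝ) ^ 2)⁻¹ := by
    rw [rpow_neg hi'.le]
    norm_num
  rw [h3, h4]
  have h5 : (i * (i + 2) : ℝ)⁻¹ ≤ ((i : ℝ) ^ 2)⁻¹ := inv_anti₀ (by positivity) (by nlinarith)
  have h6 : 0 ≤ ((i : ℝ) ^ 2)⁻¹ := by positivity
  nlinarith

lemma summable_negMulLog_gaussDigit :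
    Summable fun i => negMulLog (gaussMeasure (gaussDigit ⁻¹' {i})).toReal := by
  have hs : Summable fun i : ℕ => (3 * 2 ^ (2 / 3 : ℝ)) * (i : ℝ) ^ (-(4 / 3) : ℝ) :=
    (summable_nat_rpow.2 (by norm_num)).mul_left _
  refine Summable.of_nonneg_of_le
    (fun i => negMulLog_nonneg ENNReal.toReal_nonneg measureReal_le_one) (fun i => ?_) hs
  refine (negMulLog_le_rpow ENNReal.toReal_nonneg).trans ?_
  have h1 := rpow_le_rpow ENNReal.toReal_nonneg (gaussMeasure_gaussDigit_le i)
    (z := 2 / 3) (by norm_num)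
  rw [mul_rpow (by norm_num) (by positivity), ← rpow_mul (by positivity)] at h1
  norm_num at h1 ⊢
  linarith

end GaussDigits

section Comparison

lemma shEntropy_eq_toReal_ent {I : Type*} {μ : Measure ℝ} [IsProbabilityMeasure μ] {P : I → Set ℝ}
    {X : ℝ → I} (h : ∀ i, μ (P i) = μ (X ⁻¹' {i})) : shEntropy μ P = (ent μ X).toReal := by
  rw [shEntropy, ent, ENNReal.tsum_toReal_eq fun i => ENNReal.ofReal_ne_top]
  refine tsum_congr fun i => ?_
  rw [h, ENNReal.toReal_ofReal (negMulLog_nonneg ENNReal.toReal_nonneg measureReal_le_one)]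

lemma ent_ne_top {I : Type*} {μ : Measure ℝ} [IsProbabilityMeasure μ] {X : ℝ → I}
    (h : Summable fun i => negMulLog (μ (X ⁻¹' {i})).toReal) : ent μ X ≠ ∞ := by
  rw [ent, ← ENNReal.ofReal_tsum_of_nonneg
    (fun i => negMulLog_nonneg ENNReal.toReal_nonneg measureReal_le_one) h]
  exact ENNReal.ofReal_ne_top

lemma permEntropy_gaussMap : permEntropy (Set.Icc 0 1) gaussMeasure gaussMap =
    liminf (fun n : ℕ => (ent gaussMeasure (orbitPattern gaussMap n)).toReal / n) atTop := by
  unfold permEntropy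
  congr 1
  funext n
  rw [shEntropy_eq_toReal_ent fun σ => ?_]
  refine measure_congr ?_
  filter_upwards [ae_injective_orbit, ae_mem_Icc] with ω hinj hω
  refine propext ⟨fun h => ?_, fun h => ⟨hω, fun k l hkl => ?_⟩⟩
  · refine (Tuple.eq_sort_iff.2 ⟨fun k l hkl => h.2 k l hkl, fun k l hkl heq => ?_⟩).symm
    exact absurd (σ.injective (Fin.ext (hinj heq))) hkl.ne
  · have h' : orbitPattern gaussMap n ω = σ := h
    rw [← h']
    exact Tuple.monotone_sort (fun k : Fin n => gaussMap^[k] ω) hkl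

lemma entropyRate_gaussMap {I : Type*} {P : I → Set ℝ} {X : ℝ → I}
    (h : ∀ x ∈ Set.Icc (0 : ℝ) 1, ∀ i, x ∈ P i ↔ X x = i) :
    entropyRate gaussMeasure gaussMap P =
      liminf (fun n : ℕ => (ent gaussMeasure (word gaussMap X n)).toReal / n) atTop := by
  unfold entropyRate
  congr 1
  funext n
  rw [shEntropy_eq_toReal_ent fun a => ?_]
  refine measure_congr ?_
  filter_upwards [ae_gaussRegular] with ω hω
  refine propext (Set.mem_iInter.trans ?_)
  change _ ↔ word gaussMap X n ω = a
  rw [funext_iff]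
  exact forall_congr' fun k => h _ ⟨(hω k).1.le, (hω k).2.le⟩ _

lemma exists_label {Ω : Set ℝ} (hΩ : MeasurableSet Ω) {P : ℕ → Set ℝ} (hP : IsPartitionOf Ω P)
    (hPm : ∀ i, MeasurableSet (P i)) :
    ∃ X : ℝ → ℕ, FibreMeasurable X ∧ ∀ x ∈ Ω, ∀ i, x ∈ P i ↔ X x = i := by
  classical
  obtain ⟨hdisj, rfl⟩ := hP
  let X : ℝ → ℕ := fun x => if h : ∃ i, x ∈ P i then Nat.find h else 0
  have hX : ∀ x ∈ ⋃ i, P i, ∀ i, x ∈ P i ↔ X x = i := by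
    intro x hx i
    have hex := Set.mem_iUnion.1 hx
    have hXx : X x = Nat.find hex := dif_pos hex
    have hmem : x ∈ P (X x) := hXx ▸ Nat.find_spec hex
    refine ⟨fun hi => ?_, fun hi => hi ▸ hmem⟩
    by_contra hne
    exact Set.disjoint_left.1 (hdisj hne) hmem hi
  refine ⟨X, fun i => ?_, hX⟩
  have : X ⁻¹' {i} = P i ∪ ((⋃ i, P i)ᶜ ∩ {_x | i = 0}) := by
    ext x
    by_cases hx : x ∈ ⋃ i, P i
    · simp only [Set.mem_union, Set.mem_inter_iff, Set.mem_compl_iff, hx, not_true, false_and,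
        or_false, hX x hx i, Set.mem_preimage, Set.mem_singleton_iff]
    · have h1 : X x = 0 := dif_neg fun h => hx (Set.mem_iUnion.2 h)
      have h2 : x ∉ P i := fun h => hx (Set.mem_iUnion.2 ⟨i, h⟩)
      simp only [Set.mem_union, Set.mem_inter_iff, Set.mem_compl_iff, hx, not_false_eq_true,
        true_and, h2, false_or, Set.mem_preimage, Set.mem_singleton_iff, h1, Set.mem_ofPred_eq]
      exact eq_comm
  rw [this]
  exact (hPm i).union (hΩ.compl.inter (.const _))

lemma liminf_le_liminf_of_forall_le_add {u v : ℕ → ℝ} {C : ℝ} (hu : ∀ n, 0 ≤ u n)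
    (hv : ∀ᶠ n in atTop, v n ≤ C) (huv : ∀ ε > 0, ∀ᶠ n in atTop, u n ≤ v n + ε) :
    liminf u atTop ≤ liminf v atTop := by
  refine le_of_forall_pos_le_add fun ε hε => ?_
  have hub : IsBoundedUnder (· ≥ ·) atTop u := isBoundedUnder_of ⟨0, hu⟩
  have hvc : IsCoboundedUnder (· ≥ ·) atTop v :=
    (isBoundedUnder_of_eventually_le hv).isCoboundedUnder_ge
  rw [← sub_le_iff_le_add]
  refine le_liminf_of_le hvc ?_
  have h1 : ∀ᶠ n in atTop, liminf u atTop - ε / 2 < u n :=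
    eventually_lt_of_lt_liminf (by linarith) hub
  filter_upwards [h1, huv (ε / 2) (by positivity)] with n hn1 hn2
  linarith

lemma tendsto_log_succ_div : Tendsto (fun n : ℕ => log (n + 1) / n) atTop (nhds 0) := by
  have h := (tendsto_pow_log_div_mul_add_atTop 1 (-1) 1 one_ne_zero).comp
    (tendsto_natCast_atTop_atTop.comp (tendsto_add_atTop_nat 1) :
      Tendsto (fun n : ℕ => ((n + 1 : ℕ) : ℝ)) atTop atTop)
  refine h.congr fun n => ?_
  simp

lemma ent_orbitPattern_div_le {n : ℕ} (hn : 0 < n) :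
    (ent gaussMeasure (orbitPattern gaussMap n)).toReal / n ≤
      (ent gaussMeasure (word gaussMap gaussDigit n)).toReal / n + log (n + 1) / n := by
  obtain ⟨N, rfl⟩ := Nat.exists_eq_add_of_lt hn
  rw [zero_add, ← add_div]
  gcongr
  have hlog : 0 ≤ log ((N + 1 : ℕ) + 1) := log_nonneg (le_add_of_nonneg_left (Nat.cast_nonneg _))
  refine ENNReal.toReal_le_of_le_ofReal (by positivity) ?_
  rw [ENNReal.ofReal_add ENNReal.toReal_nonneg hlog, ENNReal.ofReal_toReal]
  · exact ent_orbitPattern_gaussMap_le N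
  · exact ((ent_word_le measurePreserving_gaussMap fibreMeasurable_gaussDigit _).trans_lt
      (ENNReal.mul_lt_top (ENNReal.natCast_lt_top _)
        (ent_ne_top summable_negMulLog_gaussDigit).lt_top)).ne

lemma ent_word_div_le {X : ℝ → ℕ} (hX : FibreMeasurable X) (hfin : ent gaussMeasure X ≠ ∞)
    (n : ℕ) : (ent gaussMeasure (word gaussMap X n)).toReal / n ≤ (ent gaussMeasure X).toReal := by
  refine div_le_of_le_mul₀ (by positivity) ENNReal.toReal_nonneg ?_
  have := ENNReal.toReal_mono (ENNReal.mul_ne_top (ENNReal.natCast_ne_top n) hfin)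
    (ent_word_le measurePreserving_gaussMap hX n)
  rwa [ENNReal.toReal_mul, ENNReal.toReal_natCast, mul_comm] at this

lemma exists_eventually_ent_orbitPattern_div_le : ∃ C : ℝ, ∀ᶠ n : ℕ in atTop,
    (ent gaussMeasure (orbitPattern gaussMap n)).toReal / n ≤ C := by
  refine ⟨(ent gaussMeasure gaussDigit).toReal + 1, ?_⟩
  filter_upwards [eventually_gt_atTop 0, tendsto_log_succ_div.eventually_lt_const one_pos]
    with n hn hlog
  have h1 := ent_orbitPattern_div_le hn
  have h2 := ent_word_div_le fibreMeasurable_gaussDigit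
    (ent_ne_top summable_negMulLog_gaussDigit) n
  linarith

lemma permEntropy_gaussMap_le :
    permEntropy (Set.Icc 0 1) gaussMeasure gaussMap ≤
      liminf (fun n : ℕ => (ent gaussMeasure (word gaussMap gaussDigit n)).toReal / n) atTop := by
  rw [permEntropy_gaussMap]
  refine liminf_le_liminf_of_forall_le_add (fun n => by positivity)
    (Eventually.of_forall (ent_word_div_le fibreMeasurable_gaussDigit
      (ent_ne_top summable_negMulLog_gaussDigit))) fun ε hε => ?_
  filter_upwards [eventually_gt_atTop 0, tendsto_log_succ_div.eventually_lt_const hε]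
    with n hn hlog
  linarith [ent_orbitPattern_div_le hn]

lemma liminf_ent_word_le_permEntropy {X : ℝ → ℕ} (hX : FibreMeasurable X)
    (hfin : ent gaussMeasure X ≠ ∞) :
    liminf (fun n : ℕ => (ent gaussMeasure (word gaussMap X n)).toReal / n) atTop ≤
      permEntropy (Set.Icc 0 1) gaussMeasure gaussMap := by
  rw [permEntropy_gaussMap]
  obtain ⟨K, hK⟩ := exists_eventually_ent_orbitPattern_div_le
  refine liminf_le_liminf_of_forall_le_add (fun n => by positivity) hK fun ε hε => ?_
  obtain ⟨C, hC⟩ := exists_ent_word_le_ent_orbitPattern measurePreserving_gaussMap hX hfin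
    (half_pos hε)
  have hlim : Tendsto (fun n : ℕ => C * (log (n + 1) / n)) atTop (nhds 0) := by
    simpa using tendsto_log_succ_div.const_mul (C : ℝ)
  filter_upwards [eventually_gt_atTop 0, hlim.eventually_lt_const (half_pos hε)] with n hn hlog
  have hn' : (0 : ℝ) < n := by exact_mod_cast hn
  have hl : 0 ≤ log ((n : ℝ) + 1) := log_nonneg (by linarith)
  have hpat : ent gaussMeasure (orbitPattern gaussMap n) ≠ ∞ :=
    ((ent_le_log_card (fibreMeasurable_orbitPattern measurable_gaussMap n)).trans_lt
      ENNReal.ofReal_lt_top).ne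
  have h1 : (ent gaussMeasure (word gaussMap X n)).toReal ≤
      (ent gaussMeasure (orbitPattern gaussMap n)).toReal + (C * log (n + 1) + n * (ε / 2)) := by
    refine ENNReal.toReal_le_of_le_ofReal (by positivity) ?_
    rw [ENNReal.ofReal_add ENNReal.toReal_nonneg (by positivity), ENNReal.ofReal_toReal hpat]
    exact hC n
  have h2 := div_le_div_of_nonneg_right h1 hn'.le
  have h3 : ((ent gaussMeasure (orbitPattern gaussMap n)).toReal +
      (C * log (n + 1) + n * (ε / 2))) / n =
      (ent gaussMeasure (orbitPattern gaussMap n)).toReal / n + C * (log (n + 1) / n) + ε / 2 := by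
    field_simp
    ring
  linarith

end Comparison

theorem stmt15 :
    permEntropy (Set.Icc 0 1) gaussMeasure gaussMap =
      ksEntropy (Set.Icc 0 1) gaussMeasure gaussMap := by
  have hub : ∀ h ∈ {h : ℝ | ∃ P : ℕ → Set ℝ, IsPartitionOf (Set.Icc 0 1) P ∧
      (∀ i, MeasurableSet (P i)) ∧
      (Summable fun i => Real.negMulLog (gaussMeasure (P i)).toReal) ∧
      h = entropyRate gaussMeasure gaussMap P},
      h ≤ permEntropy (Set.Icc 0 1) gaussMeasure gaussMap := by
    rintro _ ⟨P, hP, hPm, hPs, rfl⟩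
    obtain ⟨X, hX, hPX⟩ := exists_label measurableSet_Icc hP hPm
    rw [entropyRate_gaussMap hPX]
    refine liminf_ent_word_le_permEntropy hX (ent_ne_top (hPs.congr fun i => ?_))
    congr 2
    refine measure_congr ?_
    filter_upwards [ae_mem_Icc] with ω hω
    exact propext (hPX ω hω i)
  refine le_antisymm (permEntropy_gaussMap_le.trans (le_csSup ⟨_, hub⟩ ?hmem))
    (csSup_le ⟨_, ?hmem⟩ hub)
  refine ⟨fun i => gaussDigit ⁻¹' {i} ∩ Set.Icc 0 1, ⟨fun i j hij => ?_, ?_⟩,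
    fun i => (fibreMeasurable_gaussDigit i).inter measurableSet_Icc, ?_,
    (entropyRate_gaussMap fun x hx i => ?_).symm⟩
  · exact Set.disjoint_left.2 fun x hi hj => hij (hi.1.symm.trans hj.1)
  · rw [← Set.iUnion_inter, Set.inter_eq_right]
    exact fun x _ => Set.mem_iUnion.2 ⟨gaussDigit x, rfl⟩
  · refine summable_negMulLog_gaussDigit.congr fun i => ?_
    congr 2
    refine measure_congr ?_
    filter_upwards [ae_mem_Icc] with ω hω
    exact propext ⟨fun h => ⟨h, hω⟩, fun h => h.1⟩
  · exact ⟨fun h => h.1, fun h => ⟨h, hx⟩⟩
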